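/- Fix k ≥ 2. Let φ(p₁,…,pₙ) and θ(q₁,…,q_m) be propositional dependence logic formulas over disjoint sets of variables, and suppose θ is not k-coherent. Then φ is valid (i.e., every propositional team with domain {p₁,…,pₙ} satisfies φ) if and only if the formula φ ∨ θ, evaluated over teams with domain {p₁,…,pₙ,q₁,…,q_m}, is k-coherent. -/

import Mathlib

/-! Propositional dependence logic with team semantics. -/

/-- Formulas of propositional dependence logic over propositional variables `P`. -/
inductive PDL (P : Type) : Type where
  | var (p : P) : PDL P
  | nvar (p : P) : PDL P
  | dep (m : ℕ) (ps : Fin m → P) (q : P) : PDL P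
  | and (φ ψ : PDL P) : PDL P
  | or (φ ψ : PDL P) : PDL P

/-- Team semantics for propositional dependence logic: a propositional team is a
set of assignments `P → Bool`. -/
def PSat {P : Type} : Set (P → Bool) → PDL P → Prop
  | T, .var p => ∀ s ∈ T, s p = true
  | T, .nvar p => ∀ s ∈ T, s p = false
  | T, .dep _ ps q => ∀ s₁ ∈ T, ∀ s₂ ∈ T, (∀ i, s₁ (ps i) = s₂ (ps i)) → s₁ q = s₂ q
  | T, .and φ ψ => PSat T φ ∧ PSat T ψ
  | T, .or φ ψ => ∃ T₁ T₂, T = T₁ ∪ T₂ ∧ PSat T₁ φ ∧ PSat T₂ ψ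

/-- `φ` is `k`-coherent: a propositional team satisfies `φ` iff all its subteams
with at most `k` elements do. -/
def PKCoherent {P : Type} (k : ℕ) (φ : PDL P) : Prop :=
  ∀ T : Set (P → Bool), PSat T φ ↔ ∀ S ⊆ T, S.Finite → S.ncard ≤ k → PSat S φ

/-- Renaming of propositional variables. -/
def PDL.map {P Q : Type} (f : P → Q) : PDL P → PDL Q
  | .var p => .var (f p)
  | .nvar p => .nvar (f p)
  | .dep m ps q => .dep m (fun i => f (ps i)) (f q)
  | .and φ ψ => .and (PDL.map f φ) (PDL.map f ψ)
  | .or φ ψ => .or (PDL.map f φ) (PDL.map f ψ)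

theorem psat_empty {P : Type} (φ : PDL P) : PSat ∅ φ := by
  induction φ with
  | var p => simp [PSat]
  | nvar p => simp [PSat]
  | dep m ps q => simp [PSat]
  | and φ ψ h1 h2 => exact ⟨h1, h2⟩
  | or φ ψ h1 h2 => exact ⟨∅, ∅, by simp, h1, h2⟩

theorem psat_mono {P : Type} (φ : PDL P) :
    ∀ {S T : Set (P → Bool)}, S ⊆ T → PSat T φ → PSat S φ := by
  induction φ with
  | var p => exact fun h hT s hs => hT s (h hs)
  | nvar p => exact fun h hT s hs => hT s (h hs)
  | dep m ps q => exact fun h hT s hs t ht => hT s (h hs) t (h ht)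
  | and φ ψ h1 h2 => exact fun h hT => ⟨h1 h hT.1, h2 h hT.2⟩
  | or φ ψ h1 h2 =>
    rintro S T h ⟨A, B, rfl, hA, hB⟩
    refine ⟨S ∩ A, S ∩ B, ?_, h1 Set.inter_subset_right hA, h2 Set.inter_subset_right hB⟩
    rw [← Set.inter_union_distrib_left, Set.inter_eq_left.2 h]

theorem psat_map {P Q : Type} (f : P → Q) (φ : PDL P) :
    ∀ T : Set (Q → Bool), PSat T (PDL.map f φ) ↔ PSat ((fun s => s ∘ f) '' T) φ := by
  induction φ with
  | var p => intro T; simp [PSat, PDL.map]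
  | nvar p => intro T; simp [PSat, PDL.map]
  | dep m ps q => intro T; simp [PSat, PDL.map]
  | and φ ψ h1 h2 => intro T; simp only [PSat, PDL.map, h1, h2]
  | or φ ψ h1 h2 =>
    intro T
    simp only [PSat, PDL.map, h1, h2]
    constructor
    · rintro ⟨A, B, rfl, hA, hB⟩
      exact ⟨_, _, Set.image_union _ _ _, hA, hB⟩
    · rintro ⟨A, B, h, hA, hB⟩
      refine ⟨T ∩ (fun s => s ∘ f) ⁻¹' A, T ∩ (fun s => s ∘ f) ⁻¹' B, ?_,
        psat_mono _ ?_ hA, psat_mono _ ?_ hB⟩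
      · ext s
        constructor
        · intro hs
          have : s ∘ f ∈ A ∪ B := h ▸ Set.mem_image_of_mem _ hs
          rcases this with h | h
          · exact Or.inl ⟨hs, h⟩
          · exact Or.inr ⟨hs, h⟩
        · rintro (h | h) <;> exact h.1
      · rintro _ ⟨s, hs, rfl⟩; exact hs.2
      · rintro _ ⟨s, hs, rfl⟩; exact hs.2

/-- Fix `k ≥ 2`. If `φ(p₁,…,pₙ)` and `θ(q₁,…,q_m)` are PDL formulas
over disjoint variables and `θ` is not `k`-coherent, then `φ` is valid iff `φ ∨ θ`
(over the combined variables) is `k`-coherent. -/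
theorem stmt17 (k : ℕ) (hk : 2 ≤ k) (n m : ℕ) (φ : PDL (Fin n)) (θ : PDL (Fin m))
    (hθ : ¬ PKCoherent k θ) :
    (∀ T : Set (Fin n → Bool), PSat T φ) ↔
      PKCoherent k (.or (PDL.map Sum.inl φ) (PDL.map Sum.inr θ) :
        PDL (Fin n ⊕ Fin m)) := by
  constructor
  · intro hv T
    have key : ∀ T : Set (Fin n ⊕ Fin m → Bool),
        PSat T (.or (PDL.map Sum.inl φ) (PDL.map Sum.inr θ)) := fun T =>
      ⟨T, ∅, by simp, (psat_map _ _ _).2 (hv _), psat_empty _⟩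
    exact ⟨fun _ S _ _ _ => key S, fun _ => key T⟩
  · intro hc
    by_contra hv
    push Not at hv
    obtain ⟨T₀, hT₀⟩ := hv
    apply hθ
    intro T
    refine ⟨fun h S hS _ _ => psat_mono _ hS h, fun h => ?_⟩
    have hX := (hc {s | s ∘ Sum.inr ∈ T}).2 (by
      intro S hS hfin hcard
      refine ⟨∅, S, by simp, psat_empty _, (psat_map _ _ _).2 (h _ ?_ (hfin.image _)
        ((Set.ncard_image_le hfin).trans hcard))⟩
      rintro _ ⟨s, hs, rfl⟩
      exact hS hs)
    obtain ⟨A, B, hAB, hA, hB⟩ := hX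
    rw [psat_map] at hA hB
    have : ∃ x, x ∉ (fun s : Fin n ⊕ Fin m → Bool => s ∘ Sum.inl) '' A := by
      by_contra hx
      push Not at hx
      exact hT₀ (psat_mono _ (fun x _ => hx x) hA)
    obtain ⟨x, hx⟩ := this
    refine psat_mono _ (fun t ht => ?_) hB
    have hm : Sum.elim x t ∈ A ∪ B := by
      rw [← hAB]
      simpa using ht
    rcases hm with hm | hm
    · exact absurd ⟨_, hm, by simp⟩ hx
    · exact ⟨_, hm, by simp⟩
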